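/- arXiv:2301.00569 — 2 statements merged into one kernel-verified Lean document; each statement's English description precedes it below -/
import Mathlib

section
/- Let (R, m) be a one-dimensional Cohen-Macaulay local ring and I an m-primary ideal with μ(mI) ≤ μ(I) = e(R) − 1. Then mI is Elias and mI : m = I. -/
open CategoryTheory IsLocalRing

universe u

/-- The length of a module, as the Krull dimension of its submodule lattice. -/
noncomputable def rlength (R : Type u) (M : Type*) [Ring R] [AddCommGroup M]
    [Module R M] : WithBot ℕ∞ :=
  Order.krullDim (Submodule R M)

/-- `dim_k Ext^1_R(k, M)` (measured as `R`-length, which agrees with `k`-dimension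
since the module is killed by the maximal ideal). -/
noncomputable def modType (R : Type u) [CommRing R] [IsLocalRing R]
    (M : ModuleCat.{u} R) : WithBot ℕ∞ :=
  rlength R (((_root_.Ext R (ModuleCat.{u} R) 1).obj
    (Opposite.op (ModuleCat.of R (ResidueField R)))).obj M)

/-- The Cohen–Macaulay type of an `m`-primary ideal `I`:  `dim_k Ext^1_R(k, I)`. -/
noncomputable def idealType (R : Type u) [CommRing R] [IsLocalRing R] (I : Ideal R) :
    WithBot ℕ∞ :=
  modType R (ModuleCat.of R I)

/-- The Cohen–Macaulay type of `R/I`: `dim_k Hom_R(k, R/I)`. -/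
noncomputable def quotType (R : Type u) [CommRing R] [IsLocalRing R] (I : Ideal R) :
    WithBot ℕ∞ :=
  rlength R (ResidueField R →ₗ[R] R ⧸ I)

/-- An ideal is `m`-primary iff its radical is the maximal ideal. -/
def IsMPrimary (R : Type u) [CommRing R] [IsLocalRing R] (I : Ideal R) : Prop :=
  I.radical = maximalIdeal R

/-- `I` is Elias if `type(I) = type(R/I)`. -/
def EliasIdeal (R : Type u) [CommRing R] [IsLocalRing R] (I : Ideal R) : Prop :=
  idealType R I = quotType R I

/-- The minimal number of generators, as `dim_k I/mI`. -/
noncomputable def mu (R : Type u) [CommRing R] [IsLocalRing R] (I : Ideal R) :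
    WithBot ℕ∞ :=
  rlength R (I ⧸ (maximalIdeal R • ⊤ : Submodule R I))

/-- `R` has Hilbert–Samuel multiplicity `e`. -/
def HasMultiplicity (R : Type u) [CommRing R] [IsLocalRing R] (e : ℕ) : Prop :=
  ∃ N : ℕ, ∀ n ≥ N,
    rlength R (R ⧸ (maximalIdeal R) ^ (n + 1)) =
      rlength R (R ⧸ (maximalIdeal R) ^ n) + (e : WithBot ℕ∞)

theorem Submodule.length_quotient_map_of_injective {R F : Type*} [CommRing R] [AddCommGroup F]
    [Module R F] (G : F →ₗ[R] F) (hG : Function.Injective G) (N : Submodule R F) :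
    Module.length R (F ⧸ N.map G) =
      Module.length R (F ⧸ N) + Module.length R (F ⧸ LinearMap.range G) := by
  have hle : N.map G ≤ (LinearMap.range G).comap LinearMap.id := by
    rintro _ ⟨y, -, rfl⟩
    exact ⟨y, rfl⟩
  refine Module.length_eq_add_of_exact (N.mapQ (N.map G) G (Submodule.le_comap_map G N))
    ((N.map G).mapQ (LinearMap.range G) LinearMap.id hle) ?_ ?_ ?_
  · rw [← LinearMap.ker_eq_bot, Submodule.ker_mapQ, Submodule.comap_map_eq_of_injective hG,
      Submodule.mkQ_map_self]
  · rintro ⟨y⟩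
    exact ⟨Submodule.Quotient.mk y, rfl⟩
  · rintro ⟨y⟩
    constructor
    · intro h
      obtain ⟨z, rfl⟩ := (Submodule.Quotient.mk_eq_zero _).1 h
      exact ⟨Submodule.Quotient.mk z, rfl⟩
    · rintro ⟨⟨z⟩, h⟩
      rw [← h]
      exact (Submodule.Quotient.mk_eq_zero _).2 ⟨z, rfl⟩

theorem Submodule.length_quotient_eq_add_of_le {R F : Type*} [CommRing R] [AddCommGroup F]
    [Module R F] {A B : Submodule R F} (h : A ≤ B) :
    Module.length R (F ⧸ A) =
      Module.length R (B ⧸ A.submoduleOf B) + Module.length R (F ⧸ B) := by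
  refine Module.length_eq_add_of_exact ((A.submoduleOf B).mapQ A B.subtype
    (show A.submoduleOf B ≤ A.comap B.subtype from le_rfl))
    (A.mapQ B LinearMap.id h) ?_ ?_ ?_
  · rw [← LinearMap.ker_eq_bot, eq_bot_iff]
    rintro ⟨y⟩ hy
    exact (Submodule.Quotient.mk_eq_zero _).2 ((Submodule.Quotient.mk_eq_zero A).1 hy)
  · rintro ⟨y⟩
    exact ⟨Submodule.Quotient.mk y, rfl⟩
  · rintro ⟨y⟩
    constructor
    · intro h
      exact ⟨Submodule.Quotient.mk ⟨y, (Submodule.Quotient.mk_eq_zero _).1 h⟩, rfl⟩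
    · rintro ⟨⟨z⟩, h⟩
      rw [← h]
      exact (Submodule.Quotient.mk_eq_zero _).2 z.2

theorem Ideal.length_quotient_smul_top {R F : Type*} [CommRing R] [Nontrivial R] [AddCommGroup F]
    [Module R F] [Module.Free R F] [Module.Finite R F] (I : Ideal R) :
    Module.length R (F ⧸ (I • ⊤ : Submodule R F)) =
      Module.finrank R F * Module.length R (R ⧸ I) := by
  let b := Module.Free.chooseBasis R F
  rw [← (TensorProduct.quotTensorEquivQuotSMul F I).length_eq,
    (TensorProduct.congr (LinearEquiv.refl R (R ⧸ I)) b.equivFun).length_eq,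
    (TensorProduct.piScalarRight R R (R ⧸ I) _).length_eq, Module.length_pi,
    Module.finrank_eq_card_basis b]
  simp

theorem Submodule.eq_of_le_of_length_quotient_eq {R F : Type*} [CommRing R] [AddCommGroup F]
    [Module R F] {A B : Submodule R F} (h : A ≤ B) (hfin : Module.length R (F ⧸ B) ≠ ⊤)
    (heq : Module.length R (F ⧸ A) = Module.length R (F ⧸ B)) : A = B := by
  rw [length_quotient_eq_add_of_le h] at heq
  have h0 : Module.length R (B ⧸ A.submoduleOf B) = 0 := by
    exact WithTop.add_right_cancel hfin (heq.trans (zero_add _).symm)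
  rw [Module.length_eq_zero_iff, Submodule.Quotient.subsingleton_iff,
    Submodule.submoduleOf_eq_top] at h0
  exact le_antisymm h h0

theorem Submodule.length_quotient_anti {R F : Type*} [CommRing R] [AddCommGroup F]
    [Module R F] {A B : Submodule R F} (h : A ≤ B) :
    Module.length R (F ⧸ B) ≤ Module.length R (F ⧸ A) := by
  rw [length_quotient_eq_add_of_le h]
  exact le_add_self

theorem Ideal.length_quotient_span_singleton_mul {R : Type*} [CommRing R]
    {x : R} (hx : x ∈ nonZeroDivisors R) (I : Ideal R) :
    Module.length R (R ⧸ Ideal.span {x} * I) =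
      Module.length R (R ⧸ I) + Module.length R (R ⧸ Ideal.span {x}) := by
  have h := Submodule.length_quotient_map_of_injective (LinearMap.mulLeft R x)
    (fun a b h => (mul_cancel_left_mem_nonZeroDivisors hx).1 h) I
  have h1 : Submodule.map (LinearMap.mulLeft R x) I = Ideal.span {x} * I := by
    ext y
    simp [Ideal.mem_span_singleton_mul]
  have h2 : LinearMap.range (LinearMap.mulLeft R x) = Ideal.span {x} := by
    ext y
    simp [Ideal.mem_span_singleton', mul_comm x]
  rwa [h1, h2] at h

theorem Ideal.length_quotient_pow_ne_top {R : Type*} [CommRing R] [IsNoetherianRing R]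
    [Ring.KrullDimLE 1 R] {I : Ideal R} {x : R} (hxI : x ∈ I) (hx : x ∈ nonZeroDivisors R)
    (n : ℕ) : Module.length R (R ⧸ I ^ n) ≠ ⊤ := by
  have h : Module.length R (R ⧸ Ideal.span {x ^ n}) ≠ ⊤ :=
    Module.length_ne_top_iff.2 (isFiniteLength_quotient_span_singleton R (pow_mem hx n))
  refine ne_top_of_le_ne_top h (Submodule.length_quotient_anti ?_)
  exact (Ideal.span_singleton_le_iff_mem _).2 (Ideal.pow_mem_pow hxI n)

theorem Ideal.length_quotient_mul {R : Type*} [CommRing R] (J I : Ideal R) :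
    Module.length R (R ⧸ J * I) =
      Module.length R (I ⧸ (J • ⊤ : Submodule R I)) + Module.length R (R ⧸ I) := by
  rw [Submodule.length_quotient_eq_add_of_le (Ideal.mul_le_right : J * I ≤ I)]
  congr 1
  have : (J * I).submoduleOf I = (J • ⊤ : Submodule R I) := by
    apply Submodule.map_injective_of_injective I.subtype_injective
    rw [Submodule.map_smul'', Submodule.submoduleOf, Submodule.map_comap_subtype]
    simp [Ideal.mul_le_right]
  rw [this]

theorem Ideal.exists_forall_ge_mem_pow_of_mul_mem {R : Type*} [CommRing R] [IsNoetherianRing R]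
    {I : Ideal R} {x : R} (hxI : x ∈ I) (hx : x ∈ nonZeroDivisors R) :
    ∃ n₀ : ℕ, ∀ n ≥ n₀, ∀ y : R, (∀ a ∈ I, a * y ∈ I ^ (n + 2)) → y ∈ I ^ (n + 1) := by
  let F : I.Filtration R :=
    { N := fun n => Submodule.map (LinearMap.mulLeft R x) ((I ^ (n + 1)).colon (I : Set R))
      mono := fun n => Submodule.map_mono fun y hy => by
        rw [Submodule.mem_colon] at hy ⊢
        exact fun a ha => Ideal.pow_le_pow_right (Nat.le_succ _) (hy a ha)
      smul_le := fun n => by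
        rw [← Submodule.map_smul'']
        refine Submodule.map_mono (Submodule.smul_le.2 fun b hb y hy => ?_)
        rw [Submodule.mem_colon] at hy ⊢
        intro a ha
        rw [smul_assoc, pow_succ']
        exact Ideal.mul_mem_mul hb (hy a ha) }
  have hle : F ≤ I.stableFiltration ⊤ := by
    intro n w hw
    obtain ⟨y, hy, rfl⟩ := hw
    have := Submodule.mem_colon.1 hy x hxI
    rw [smul_eq_mul, mul_comm] at this
    simpa using Ideal.pow_le_pow_right (Nat.le_succ n) this
  obtain ⟨n₀, h⟩ := (I.stableFiltration_stable (⊤ : Submodule R R)).of_le hle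
  refine ⟨n₀, fun n hn y hy => ?_⟩
  have h1 : x * y ∈ F.N (n + 1) :=
    ⟨y, Submodule.mem_colon.2 fun a ha => by rw [smul_eq_mul, mul_comm]; exact hy a ha, rfl⟩
  rw [← h n hn, ← Submodule.map_smul''] at h1
  obtain ⟨z, hz, hzy⟩ := h1
  obtain rfl : z = y := (mul_cancel_left_mem_nonZeroDivisors hx).1 hzy
  refine Submodule.smul_le.2 (fun b hb w hw => ?_) hz
  rw [smul_eq_mul, mul_comm]
  exact Submodule.mem_colon.1 hw b hb

open Polynomial in
theorem Polynomial.mem_map_pow_of_mul_mem {R : Type*} [CommRing R] {g : R[X]} {n₀ : ℕ}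
    (h : ∀ n ≥ n₀, ∀ y : R, (∀ a ∈ g.contentIdeal, a * y ∈ g.contentIdeal ^ (n + 2)) →
      y ∈ g.contentIdeal ^ (n + 1)) (D : ℕ) :
    ∀ n ≥ n₀, ∀ p : R[X], p.degree < D → p ∈ (g.contentIdeal ^ n).map C →
      g * p ∈ (g.contentIdeal ^ (n + 2)).map C → p ∈ (g.contentIdeal ^ (n + 1)).map C := by
  induction D with
  | zero =>
    intro n _ p hp _ _
    rw [degree_lt_iff_coeff_zero] at hp
    obtain rfl : p = 0 := by ext i; simpa using hp i
    exact zero_mem _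
  | succ D ih =>
    intro n hn p hp hpn hgp
    have hg : ∀ i, C (g.coeff i) ∈ g.contentIdeal.map C := fun i =>
      Ideal.mem_map_of_mem _ (coeff_mem_contentIdeal _ i)
    have key : ∀ k i, g.natDegree < i + k →
        C (g.coeff i) * p ∈ (g.contentIdeal ^ (n + 2)).map C := by
      intro k
      induction k with
      | zero =>
        intro i hi
        rw [coeff_eq_zero_of_natDegree_lt (by simpa using hi)]
        simp
      | succ k ihk =>
        intro i hi
        have htop : g.coeff i * p.coeff D ∈ g.contentIdeal ^ (n + 2) := by
          have h1 := Ideal.mem_map_C_iff.1 hgp (i + D)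
          have hmem : (i, D) ∈ Finset.HasAntidiagonal.antidiagonal (i + D) := by simp
          rw [coeff_mul, ← Finset.add_sum_erase _ _ hmem] at h1
          refine (Ideal.add_mem_iff_left _ (Ideal.sum_mem _ ?_)).1 h1
          rintro ⟨j, l⟩ hjl
          simp only [Finset.mem_erase, Finset.HasAntidiagonal.mem_antidiagonal, ne_eq, Prod.mk.injEq] at hjl
          rcases lt_or_ge i j with hij | hij
          · simpa using Ideal.mem_map_C_iff.1 (ihk j (by omega)) l
          · have : p.coeff l = 0 := (degree_lt_iff_coeff_zero _ _).1 hp l (by omega)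
            simp [this]
        have hmon : C (g.coeff i) * (C (p.coeff D) * X ^ D) ∈
            (g.contentIdeal ^ (n + 2)).map C := by
          rw [← mul_assoc, ← C_mul]
          exact Ideal.mul_mem_right _ _ (Ideal.mem_map_of_mem _ htop)
        have hmap : ∀ m, (g.contentIdeal ^ (m + 1)).map (C : R →+* R[X]) =
            g.contentIdeal.map C * (g.contentIdeal ^ m).map C := fun m => by
          rw [pow_succ', Ideal.map_mul]
        have hq := ih (n + 1) (by omega) (C (g.coeff i) * (p - C (p.coeff D) * X ^ D)) ?_ ?_ ?_
        · rw [mul_sub] at hq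
          simpa using add_mem hq hmon
        · rw [degree_lt_iff_coeff_zero] at hp ⊢
          intro l hl
          rw [coeff_C_mul, coeff_sub, coeff_C_mul_X_pow]
          split_ifs with hlD
          · simp [hlD]
          · simp [hp l (by omega)]
        · rw [hmap]
          refine Ideal.mul_mem_mul (hg i) (sub_mem hpn (Ideal.mul_mem_right _ _ ?_))
          exact Ideal.mem_map_of_mem _ (Ideal.mem_map_C_iff.1 hpn D)
        · have : g * (C (g.coeff i) * (p - C (p.coeff D) * X ^ D)) =
              C (g.coeff i) * (g * p) - g * (C (g.coeff i) * (C (p.coeff D) * X ^ D)) := by ring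
          rw [this, show n + 1 + 2 = (n + 2) + 1 by ring, hmap]
          refine sub_mem (Ideal.mul_mem_mul (hg i) hgp) (Ideal.mul_mem_mul ?_ hmon)
          exact Ideal.mem_map_C_iff.2 (coeff_mem_contentIdeal g)
    rw [Ideal.mem_map_C_iff]
    intro l
    refine h n hn _ fun a ha => ?_
    rw [contentIdeal_def] at ha
    induction ha using Submodule.span_induction with
    | mem a ha =>
      obtain ⟨i, -, rfl⟩ := mem_coeffs_iff.1 ha
      simpa using Ideal.mem_map_C_iff.1 (key (g.natDegree + 1) i (by omega)) l
    | zero => simp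
    | add a b _ _ h1 h2 => rw [add_mul]; exact add_mem h1 h2
    | smul r a _ h1 => rw [smul_eq_mul, mul_assoc]; exact Ideal.mul_mem_left _ _ h1

open Polynomial in
theorem Ideal.exists_contentIdeal_eq {R : Type*} [CommRing R] {I : Ideal R} (hI : I.FG) :
    ∃ g : R[X], g.contentIdeal = I := by
  obtain ⟨n, s, hs⟩ := Submodule.fg_iff_exists_fin_generating_family.1 hI
  refine ⟨∑ i : Fin n, monomial (i : ℕ) (s i), le_antisymm ?_ ?_⟩
  · rw [contentIdeal_def, Ideal.span_le]
    intro a ha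
    obtain ⟨i, -, rfl⟩ := mem_coeffs_iff.1 ha
    rw [SetLike.mem_coe, finsetSum_coeff]
    refine Submodule.sum_mem _ fun j _ => ?_
    rw [coeff_monomial]
    split_ifs
    · exact hs ▸ Submodule.subset_span ⟨j, rfl⟩
    · exact zero_mem _
  · rw [← hs, Submodule.span_le]
    rintro _ ⟨j, rfl⟩
    have := coeff_mem_contentIdeal (∑ i : Fin n, monomial (i : ℕ) (s i)) (j : ℕ)
    simpa [finsetSum_coeff, coeff_monomial, Fin.val_inj] using this

theorem IsLocalRing.exists_minimal_generators {R : Type*} [CommRing R] [IsLocalRing R]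
    {J : Ideal R} (hJ : J.FG) {e : ℕ}
    (he : Module.length R (J ⧸ (maximalIdeal R • ⊤ : Submodule R J)) = e) :
    ∃ b : Fin e → R, Ideal.span (Set.range b) = J ∧
      ∀ v : Fin e → R, ∑ j, v j * b j ∈ maximalIdeal R * J → ∀ j, v j ∈ maximalIdeal R := by
  let _ : Field (R ⧸ maximalIdeal R) := Ideal.Quotient.field _
  have : Module.Finite R J := Module.Finite.iff_fg.2 hJ
  have : Module.Finite (R ⧸ maximalIdeal R) (J ⧸ (maximalIdeal R • ⊤ : Submodule R J)) :=
    Module.Finite.of_restrictScalars_finite R _ _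
  rw [Module.length_eq_of_surjective (S := R) (R := R ⧸ maximalIdeal R)
    Ideal.Quotient.mk_surjective, Module.length_eq_finrank, Nat.cast_inj] at he
  let B := Module.finBasisOfFinrankEq (R ⧸ maximalIdeal R) _ he
  choose b hb using fun j => Submodule.Quotient.mk_surjective _ (B j)
  refine ⟨fun j => b j, ?_, fun v hv j => ?_⟩
  · have h1 : Submodule.span R (Set.range b) = ⊤ := by
      rw [← IsLocalRing.map_mkQ_eq_top, Submodule.map_span, ← Set.range_comp]
      have : (Submodule.mkQ (maximalIdeal R • ⊤ : Submodule R J)) ∘ b = B := by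
        ext j
        exact hb j
      rw [this, ← Submodule.restrictScalars_span R (R ⧸ maximalIdeal R)
        Ideal.Quotient.mk_surjective, B.span_eq, Submodule.restrictScalars_top]
    have h2 := congrArg (Submodule.map J.subtype) h1
    rw [Submodule.map_span, ← Set.range_comp, Submodule.map_subtype_top] at h2
    exact h2
  · have h1 : ∑ j, v j • b j ∈ (maximalIdeal R • ⊤ : Submodule R J) := by
      have h2 : J.subtype (∑ j, v j • b j) ∈
          (maximalIdeal R • ⊤ : Submodule R J).map J.subtype := by
        rw [Submodule.map_smul'', Submodule.map_subtype_top]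
        simpa using hv
      obtain ⟨z, hz, hzy⟩ := h2
      rwa [← J.subtype_injective hzy]
    have h3 := (Submodule.Quotient.mk_eq_zero _).2 h1
    rw [← Submodule.mkQ_apply, map_sum] at h3
    have h4 : ∑ j, (Ideal.Quotient.mk (maximalIdeal R) (v j)) • B j = 0 := by
      rw [← h3]
      refine Finset.sum_congr rfl fun j _ => ?_
      rw [map_smul, ← hb j]
      rfl
    exact Ideal.Quotient.eq_zero_iff_mem.1
      (Fintype.linearIndependent_iff.1 B.linearIndependent _ h4 j)

open Polynomial in
theorem IsLocalRing.exists_mul_C_mem_span_mul {R : Type*} [CommRing R] [IsLocalRing R]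
    {g : R[X]} {n e : ℕ} {b c : Fin e → R} (hg : g.contentIdeal = maximalIdeal R)
    (hb : Ideal.span (Set.range b) = maximalIdeal R ^ n)
    (hbi : ∀ v : Fin e → R, ∑ j, v j * b j ∈ maximalIdeal R ^ (n + 1) →
      ∀ j, v j ∈ maximalIdeal R)
    (hc : Ideal.span (Set.range c) = maximalIdeal R ^ (n + 1))
    (hinj : ∀ p ∈ (maximalIdeal R ^ n).map (C : R →+* R[X]),
      g * p ∈ (maximalIdeal R ^ (n + 2)).map C → p ∈ (maximalIdeal R ^ (n + 1)).map C) :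
    ∃ h : R[X], h.map (residue R) ≠ 0 ∧
      ∀ y ∈ maximalIdeal R ^ (n + 1), h * C y ∈ Ideal.span {g} * (maximalIdeal R ^ n).map C := by
  have hgC : g ∈ (maximalIdeal R).map C := by
    rw [Ideal.mem_map_C_iff, ← hg]
    exact coeff_mem_contentIdeal g
  have hbm : ∀ j, b j ∈ maximalIdeal R ^ n := fun j => hb ▸ Ideal.subset_span ⟨j, rfl⟩
  have hcm : ∀ j, c j ∈ maximalIdeal R ^ (n + 1) := fun j => hc ▸ Ideal.subset_span ⟨j, rfl⟩
  have hA : ∀ j, ∃ A : Fin e → R[X], ∑ l, A l * C (c l) = g * C (b j) := fun j => by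
    have h1 : g * C (b j) ∈ (maximalIdeal R ^ (n + 1)).map C := by
      rw [pow_succ', Ideal.map_mul]
      exact Ideal.mul_mem_mul hgC (Ideal.mem_map_of_mem _ (hbm j))
    rw [← hc, Ideal.map_span, ← Set.range_comp] at h1
    exact Ideal.mem_span_range_iff_exists_fun.1 h1
  choose A' hA' using hA
  let A : Matrix (Fin e) (Fin e) R[X] := Matrix.of fun l j => A' j l
  have hAC : ∀ j, g * C (b j) = ∑ l, A l j * C (c l) := fun j => (hA' j).symm
  have hgsum : ∀ w : Fin e → R[X],
      g * ∑ j, w j * C (b j) = ∑ l, (∑ j, A l j * w j) * C (c l) := fun w => by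
    simp_rw [Finset.mul_sum, Finset.sum_mul]
    rw [Finset.sum_comm]
    refine Finset.sum_congr rfl fun j _ => ?_
    rw [mul_left_comm, hAC, Finset.mul_sum]
    refine Finset.sum_congr rfl fun l _ => ?_
    ring
  refine ⟨A.det, fun h0 => ?_, fun y hy => ?_⟩
  · have h1 : (A.map (Polynomial.map (residue R))).det = 0 := by
      rw [← h0, ← coe_mapRingHom, RingHom.map_det]
      rfl
    obtain ⟨v', hv0, hv⟩ := Matrix.exists_mulVec_eq_zero_iff.2 h1
    choose v hvv using fun j => Polynomial.map_surjective _ residue_surjective (v' j)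
    have hker : ∀ p : R[X], p.map (residue R) = 0 → p ∈ (maximalIdeal R).map C := fun p hp => by
      rw [Ideal.mem_map_C_iff]
      intro i
      have := congrArg (fun q => q.coeff i) hp
      rwa [coeff_map, coeff_zero, residue_eq_zero_iff] at this
    have hAv : ∀ l, ∑ j, A l j * v j ∈ (maximalIdeal R).map C := fun l => by
      refine hker _ ?_
      rw [Polynomial.map_sum]
      refine Eq.trans ?_ (congrFun hv l)
      refine Finset.sum_congr rfl fun j _ => ?_
      rw [Polynomial.map_mul, hvv]
      rfl
    have hp := hinj (∑ j, v j * C (b j))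
      (Submodule.sum_mem _ fun j _ => Ideal.mul_mem_left _ _ (Ideal.mem_map_of_mem _ (hbm j))) ?_
    · apply hv0
      ext1 j
      rw [← hvv j, Pi.zero_apply]
      ext i
      rw [coeff_map, coeff_zero, residue_eq_zero_iff]
      refine hbi (fun j => (v j).coeff i) ?_ j
      have := Ideal.mem_map_C_iff.1 hp i
      simpa [finsetSum_coeff] using this
    · rw [hgsum, show n + 2 = (n + 1) + 1 by rfl, pow_succ', Ideal.map_mul]
      exact Submodule.sum_mem _ fun l _ =>
        Ideal.mul_mem_mul (hAv l) (Ideal.mem_map_of_mem _ (hcm l))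
  · have hdet : ∀ q, A.det * C (c q) = g * ∑ j, A.adjugate j q * C (b j) := fun q => by
      have h1 : ∀ l, ∑ j, A l j * A.adjugate j q = if l = q then A.det else 0 := fun l => by
        have := congrFun (congrFun A.mul_adjugate l) q
        rw [Matrix.mul_apply] at this
        rw [this, Matrix.smul_apply, Matrix.one_apply]
        simp
      rw [hgsum]
      simp [h1]
    rw [← hc] at hy
    obtain ⟨r, rfl⟩ := Ideal.mem_span_range_iff_exists_fun.1 hy
    rw [map_sum, Finset.mul_sum]
    refine Submodule.sum_mem _ fun q _ => ?_
    rw [map_mul, mul_left_comm, hdet]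
    refine Ideal.mul_mem_left _ _ (Ideal.mul_mem_mul (Ideal.mem_span_singleton_self g) ?_)
    exact Submodule.sum_mem _ fun j _ => Ideal.mul_mem_left _ _ (Ideal.mem_map_of_mem _ (hbm j))

open Polynomial in
theorem IsLocalRing.exists_adjoinRoot_map_le {R : Type*} [CommRing R] [IsLocalRing R]
    [IsNoetherianRing R] {g h : R[X]} {n : ℕ} (hh : h.map (residue R) ≠ 0)
    (hgh : ∀ y ∈ maximalIdeal R ^ (n + 1),
      h * C y ∈ Ideal.span {g} * (maximalIdeal R ^ n).map C) :
    ∃ f : R[X], f.Monic ∧ 0 < f.natDegree ∧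
      (maximalIdeal R ^ (n + 1)).map (algebraMap R (AdjoinRoot f)) ≤
        Ideal.span {AdjoinRoot.mk f g} *
          (maximalIdeal R ^ n).map (algebraMap R (AdjoinRoot f)) := by
  obtain ⟨u, hu⟩ := residue_surjective (R := R) (h.map (residue R)).leadingCoeff⁻¹
  have hmonic : (C (residue R u) * h.map (residue R)).Monic := by
    rw [hu, mul_comm]
    exact monic_mul_leadingCoeff_inv hh
  obtain ⟨k, hk, -, hkm⟩ := lifts_and_natDegree_eq_and_monic
    ((mem_lifts _).2 ⟨C u * h, by rw [Polynomial.map_mul, map_C]⟩) hmonic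
  have hkd : (1 : R[X]).degree < (X * k).degree := by
    rw [degree_one, X_mul, degree_mul_X, degree_eq_natDegree hkm.ne_zero]
    exact_mod_cast Nat.succ_pos _
  have hfm : (X * k + 1).Monic := (monic_X.mul hkm).add_of_left hkd
  refine ⟨X * k + 1, hfm, ?_, ?_⟩
  · rw [natDegree_add_eq_left_of_degree_lt hkd, natDegree_X_mul hkm.ne_zero]
    exact Nat.succ_pos _
  set f := X * k + 1
  have : Module.Finite R (AdjoinRoot f) := hfm.finite_adjoinRoot
  have hmk : ∀ I : Ideal R, I.map (algebraMap R (AdjoinRoot f)) =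
      (I.map C).map (AdjoinRoot.mk f) := fun I => by
    rw [Ideal.map_map]
    rfl
  have hunit : AdjoinRoot.mk f k * -AdjoinRoot.root f = 1 := by
    have h1 : AdjoinRoot.mk f (X * k + 1) = 0 := AdjoinRoot.mk_self
    rw [map_add, map_mul, map_one, AdjoinRoot.mk_X] at h1
    linear_combination -h1
  have hk2 : ∀ y ∈ maximalIdeal R ^ (n + 1), k * C y ∈
      Ideal.span {g} * (maximalIdeal R ^ n).map C ⊔ (maximalIdeal R * maximalIdeal R ^ (n + 1)).map C := by
    intro y hy
    have h1 : k - C u * h ∈ (maximalIdeal R).map C := by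
      rw [Ideal.mem_map_C_iff]
      intro i
      rw [← residue_eq_zero_iff, ← coeff_map, Polynomial.map_sub, hk, Polynomial.map_mul, map_C,
        sub_self, coeff_zero]
    have h2 : k * C y = C u * (h * C y) + (k - C u * h) * C y := by ring
    rw [h2, Ideal.map_mul]
    exact Ideal.add_mem _ (Ideal.mem_sup_left (Ideal.mul_mem_left _ _ (hgh y hy)))
      (Ideal.mem_sup_right (Ideal.mul_mem_mul h1 (Ideal.mem_map_of_mem _ hy)))
  have hle : (maximalIdeal R ^ (n + 1)).map (algebraMap R (AdjoinRoot f)) ≤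
      Ideal.span {AdjoinRoot.mk f g} * (maximalIdeal R ^ n).map (algebraMap R (AdjoinRoot f)) ⊔
      (maximalIdeal R * maximalIdeal R ^ (n + 1)).map (algebraMap R (AdjoinRoot f)) := by
    refine Ideal.map_le_iff_le_comap.2 fun y hy => ?_
    have h1 := Ideal.mem_map_of_mem (AdjoinRoot.mk f) (hk2 y hy)
    rw [Ideal.map_sup, Ideal.map_mul, Ideal.map_span, Set.image_singleton, ← hmk, ← hmk,
      map_mul] at h1
    have h2 := Ideal.mul_mem_left _ (-AdjoinRoot.root f) h1
    rwa [← mul_assoc, mul_comm (-AdjoinRoot.root f), hunit, one_mul] at h2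
  have hnak := Submodule.le_of_le_smul_of_le_jacobson_bot (I := maximalIdeal R)
    (N' := ((maximalIdeal R ^ (n + 1)).map (algebraMap R (AdjoinRoot f))).restrictScalars R)
    (N := (Ideal.span {AdjoinRoot.mk f g} *
      (maximalIdeal R ^ n).map (algebraMap R (AdjoinRoot f))).restrictScalars R)
    (IsNoetherian.noetherian _) (maximalIdeal_le_jacobson _) ?_
  · exact hnak
  · intro z hz
    have := hle hz
    rw [← Ideal.smul_top_eq_map]
    obtain ⟨a, ha, b, hb, rfl⟩ := Submodule.mem_sup.1 this
    refine Submodule.add_mem_sup ha ?_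
    rwa [← Submodule.restrictScalars_mem R, ← Ideal.smul_top_eq_map, mul_smul] at hb

theorem IsLocalRing.length_quotient_mul_le_and_eq {R : Type*} [CommRing R] [IsLocalRing R]
    [IsNoetherianRing R] [Ring.KrullDimLE 1 R] {x : R} (hxm : x ∈ maximalIdeal R)
    (hx : x ∈ nonZeroDivisors R) {e N : ℕ}
    (he : ∀ n ≥ N, Module.length R (R ⧸ maximalIdeal R ^ (n + 1)) =
      Module.length R (R ⧸ maximalIdeal R ^ n) + e)
    {M : Ideal R} (hM : Module.length R (R ⧸ M) ≠ ⊤) :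
    Module.length R (R ⧸ maximalIdeal R * M) ≤ Module.length R (R ⧸ M) + e ∧
      (Module.length R (R ⧸ maximalIdeal R * M) = Module.length R (R ⧸ M) + e →
        Module.length R (R ⧸ maximalIdeal R * (maximalIdeal R * M)) =
          Module.length R (R ⧸ maximalIdeal R * M) + e) := by
  obtain ⟨n₀, hn₀⟩ := Ideal.exists_forall_ge_mem_pow_of_mul_mem hxm hx
  obtain ⟨g, hg⟩ := Ideal.exists_contentIdeal_eq (maximalIdeal R).fg_of_isNoetherianRing
  have hfin := Ideal.length_quotient_pow_ne_top hxm hx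
  have hmu : ∀ n ≥ N, Module.length R ((maximalIdeal R ^ n : Ideal R) ⧸
      (maximalIdeal R • ⊤ : Submodule R (maximalIdeal R ^ n : Ideal R))) = e := fun n hn => by
    have h1 := he n hn
    rw [pow_succ', Ideal.length_quotient_mul, add_comm] at h1
    exact WithTop.add_left_cancel (hfin n) h1
  set n := max N n₀
  obtain ⟨b, hb, hbi⟩ := exists_minimal_generators (Ideal.fg_of_isNoetherianRing _)
    (hmu n (le_max_left _ _))
  obtain ⟨c, hc, -⟩ := exists_minimal_generators (Ideal.fg_of_isNoetherianRing _)
    (hmu (n + 1) (Nat.le_succ_of_le (le_max_left _ _)))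
  rw [← pow_succ'] at hbi
  obtain ⟨h, hh, hgh⟩ := exists_mul_C_mem_span_mul hg hb hbi hc fun p hp hgp => by
    rw [← hg] at hn₀ hp hgp ⊢
    exact Polynomial.mem_map_pow_of_mul_mem hn₀ (p.natDegree + 1) n (le_max_right _ _) p
      (Polynomial.degree_le_natDegree.trans_lt (by exact_mod_cast Nat.lt_succ_self _)) hp hgp
  obtain ⟨f, hf, hfd, hle⟩ := exists_adjoinRoot_map_le hh hgh
  have : Module.Finite R (AdjoinRoot f) := hf.finite_adjoinRoot
  have : Module.Free R (AdjoinRoot f) := hf.free_adjoinRoot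
  have hd : Module.finrank R (AdjoinRoot f) ≠ 0 := by
    rw [(AdjoinRoot.powerBasis' hf).finrank, AdjoinRoot.powerBasis'_dim]
    exact hfd.ne'
  set d := Module.finrank R (AdjoinRoot f)
  set γ := AdjoinRoot.mk f g
  set G : AdjoinRoot f →ₗ[R] AdjoinRoot f := LinearMap.mulLeft R γ
  have hγ : γ ∈ (maximalIdeal R).map (algebraMap R (AdjoinRoot f)) := by
    have h1 : g ∈ (maximalIdeal R).map Polynomial.C := by
      rw [Ideal.mem_map_C_iff, ← hg]
      exact Polynomial.coeff_mem_contentIdeal g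
    have h2 := Ideal.mem_map_of_mem (AdjoinRoot.mk f) h1
    rwa [Ideal.map_map] at h2
  have hrange : LinearMap.range G ≤ maximalIdeal R • ⊤ := by
    rintro _ ⟨s, rfl⟩
    rw [Ideal.smul_top_eq_map]
    exact Ideal.mul_mem_right _ _ hγ
  have hGmul : ∀ I : Ideal R, (I • ⊤ : Submodule R (AdjoinRoot f)).map G ≤
      (maximalIdeal R * I) • ⊤ := fun I => by
    rw [Submodule.map_smul'', Submodule.map_top, mul_comm, mul_smul]
    exact Submodule.smul_mono le_rfl hrange
  have hGpow : (maximalIdeal R ^ n • ⊤ : Submodule R (AdjoinRoot f)).map G =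
      maximalIdeal R ^ (n + 1) • ⊤ := by
    refine le_antisymm ((hGmul _).trans_eq (by rw [pow_succ'])) ?_
    intro z hz
    rw [Ideal.smul_top_eq_map] at hz
    obtain ⟨w, hw, rfl⟩ := Ideal.mem_span_singleton_mul.1 (hle hz)
    exact ⟨w, by rwa [Ideal.smul_top_eq_map], rfl⟩
  have hGinj : Function.Injective G := by
    rw [← LinearMap.ker_eq_bot, LinearMap.ker_eq_bot']
    intro s hs
    have h1 : algebraMap R (AdjoinRoot f) (x ^ (n + 1)) ∈
        Ideal.span {γ} * (maximalIdeal R ^ n).map (algebraMap R (AdjoinRoot f)) :=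
      hle (Ideal.mem_map_of_mem _ (Ideal.pow_mem_pow hxm _))
    obtain ⟨w, -, hw⟩ := Ideal.mem_span_singleton_mul.1 h1
    have h2 : algebraMap R (AdjoinRoot f) (x ^ (n + 1)) • s =
        algebraMap R (AdjoinRoot f) (x ^ (n + 1)) • 0 := by
      rw [smul_zero, smul_eq_mul, ← hw, mul_right_comm]
      rw [LinearMap.mulLeft_apply] at hs
      rw [hs, zero_mul]
    have hreg : IsSMulRegular R (x ^ (n + 1)) := fun a b hab =>
      (mul_cancel_left_mem_nonZeroDivisors (pow_mem hx _)).1 hab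
    exact IsSMulRegular.of_flat (S := AdjoinRoot f) hreg h2
  have hlen : ∀ I : Ideal R, Module.length R (AdjoinRoot f ⧸ (I • ⊤ : Submodule R _)) =
      d * Module.length R (R ⧸ I) := Ideal.length_quotient_smul_top
  have hG : ∀ I : Ideal R,
      Module.length R (AdjoinRoot f ⧸ (I • ⊤ : Submodule R (AdjoinRoot f)).map G) =
      d * (Module.length R (R ⧸ I) + e) := by
    have h1 := Submodule.length_quotient_map_of_injective G hGinj (maximalIdeal R ^ n • ⊤)
    rw [hGpow, hlen, hlen, he n (le_max_left _ _), mul_add] at h1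
    have h2 := WithTop.add_left_cancel (WithTop.mul_ne_top (ENat.natCast_ne_top d) (hfin n)) h1
    intro I
    rw [Submodule.length_quotient_map_of_injective G hGinj, hlen, ← h2, mul_add]
  have hcancel : ∀ {a b : ℕ∞}, (d : ℕ∞) * a ≤ d * b → a ≤ b :=
    (ENat.mul_le_mul_left_iff (Nat.cast_ne_zero.2 hd) (ENat.natCast_ne_top d)).1
  have hMle : Module.length R (R ⧸ maximalIdeal R * M) ≤ Module.length R (R ⧸ M) + e := by
    apply hcancel
    rw [← hlen, ← hG]
    exact Submodule.length_quotient_anti (hGmul M)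
  refine ⟨hMle, fun heq => ?_⟩
  have hfinM : Module.length R (R ⧸ maximalIdeal R * M) ≠ ⊤ :=
    ne_top_of_le_ne_top (WithTop.add_ne_top.2 ⟨hM, ENat.natCast_ne_top e⟩) hMle
  have hGM := Submodule.eq_of_le_of_length_quotient_eq (hGmul M)
    (by rw [hlen]; exact WithTop.mul_ne_top (ENat.natCast_ne_top d) hfinM)
    (by rw [hlen, hG, heq])
  have h3 := hG (maximalIdeal R * M)
  rw [mul_smul, Submodule.map_smul'', hGM, ← mul_smul, hlen] at h3
  exact le_antisymm (hcancel h3.le) (hcancel h3.ge)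

theorem IsLocalRing.mem_span_singleton_mul_of_forall_mul_mem {R : Type*} [CommRing R]
    [IsLocalRing R] [IsNoetherianRing R] [Ring.KrullDimLE 1 R] {x : R}
    (hxm : x ∈ maximalIdeal R) (hx : x ∈ nonZeroDivisors R) {e N : ℕ}
    (he : ∀ n ≥ N, Module.length R (R ⧸ maximalIdeal R ^ (n + 1)) =
      Module.length R (R ⧸ maximalIdeal R ^ n) + e)
    {I : Ideal R} (hI : maximalIdeal R ≤ I.radical)
    (hmu : Module.length R (I ⧸ (maximalIdeal R • ⊤ : Submodule R I)) = (e - 1 : ℕ))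
    (hmu' : Module.length R ((maximalIdeal R * I : Ideal R) ⧸
      (maximalIdeal R • ⊤ : Submodule R (maximalIdeal R * I : Ideal R))) ≤ (e - 1 : ℕ))
    {z : R} (hz : ∀ a ∈ maximalIdeal R, a * z ∈ Ideal.span {x} * (maximalIdeal R * I)) :
    z ∈ Ideal.span {x} * I := by
  by_contra hzI
  have hIfin : Module.length R (R ⧸ I) ≠ ⊤ := by
    obtain ⟨s, hs⟩ := Ideal.exists_pow_le_of_le_radical_of_fg hI (Ideal.fg_of_isNoetherianRing _)
    exact ne_top_of_le_ne_top (Ideal.length_quotient_pow_ne_top hxm hx s)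
      (Submodule.length_quotient_anti hs)
  have hxfin : Module.length R (R ⧸ Ideal.span {x}) ≠ ⊤ :=
    Module.length_ne_top_iff.2 (isFiniteLength_quotient_span_singleton R hx)
  set M : Ideal R := Ideal.span {x} * I ⊔ Ideal.span {z}
  have hle : Ideal.span {x} * I ≤ M := le_sup_left
  have hmM : maximalIdeal R * M = Ideal.span {x} * (maximalIdeal R * I) := by
    rw [Ideal.mul_sup, mul_left_comm, sup_eq_left, Ideal.mul_le]
    intro a ha b hb
    obtain ⟨r, rfl⟩ := Ideal.mem_span_singleton'.1 hb
    rw [show a * (r * z) = r * (a * z) by ring]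
    exact Ideal.mul_mem_left _ _ (hz a ha)
  have hpos : Module.length R (M ⧸ (Ideal.span {x} * I).submoduleOf M) ≠ 0 := fun h0 => by
    rw [Module.length_eq_zero_iff, Submodule.Quotient.subsingleton_iff,
      Submodule.submoduleOf_eq_top] at h0
    exact hzI (h0 (Ideal.mem_sup_right (Ideal.mem_span_singleton_self z)))
  have h1 := Ideal.length_quotient_span_singleton_mul hx I
  have h2 := Submodule.length_quotient_eq_add_of_le hle
  have h3 := Ideal.length_quotient_span_singleton_mul hx (maximalIdeal R * I)
  have h4 := Ideal.length_quotient_mul (maximalIdeal R) I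
  have h5 := Ideal.length_quotient_span_singleton_mul hx (maximalIdeal R * (maximalIdeal R * I))
  have h6 := Ideal.length_quotient_mul (maximalIdeal R) (maximalIdeal R * I)
  have hMfin : Module.length R (R ⧸ M) ≠ ⊤ := by
    refine ne_top_of_le_ne_top ?_ (Submodule.length_quotient_anti hle)
    rw [h1]
    exact WithTop.add_ne_top.2 ⟨hIfin, hxfin⟩
  obtain ⟨h7, h8⟩ := length_quotient_mul_le_and_eq hxm hx he hMfin
  rw [hmM] at h7 h8
  rw [mul_left_comm (maximalIdeal R), h3, h5, h6] at h8
  rw [h3] at h7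
  rw [h1] at h2
  rw [hmu] at h4
  rw [h4] at h7 h8
  have hq : Module.length R (M ⧸ (Ideal.span {x} * I).submoduleOf M) ≠ ⊤ := fun h => by
    rw [h, top_add] at h2
    exact WithTop.add_ne_top.2 ⟨hIfin, hxfin⟩ h2
  generalize Module.length R (M ⧸ (Ideal.span {x} * I).submoduleOf M) = q at *
  generalize Module.length R (R ⧸ M) = lM at *
  generalize Module.length R (R ⧸ I) = lI at *
  generalize Module.length R (R ⧸ Ideal.span {x}) = lx at *
  have hν := ne_top_of_le_ne_top (ENat.natCast_ne_top _) hmu'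
  generalize Module.length R ((maximalIdeal R * I : Ideal R) ⧸
      (maximalIdeal R • ⊤ : Submodule R (maximalIdeal R * I : Ideal R))) = ν at *
  clear h1 h3 h4 h5 h6 hmu
  lift q to ℕ using hq
  lift lM to ℕ using hMfin
  lift lI to ℕ using hIfin
  lift lx to ℕ using hxfin
  lift ν to ℕ using hν
  norm_cast at *
  omega

theorem CategoryTheory.ShortComplex.nonempty_homology_linearEquiv_range {R : Type u} [CommRing R]
    (S : ShortComplex (ModuleCat.{u} R)) {T V : Type*} [AddCommGroup T] [Module R T]
    [AddCommGroup V] [Module R V] (α : T →ₗ[R] S.X₂) (τ : T →ₗ[R] V)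
    (hα : ∀ t, S.g (α t) = 0) (hsurj : ∀ z, S.g z = 0 → ∃ t, α t = z)
    (hker : ∀ t, (∃ w, S.f w = α t) ↔ τ t = 0) :
    Nonempty (S.homology ≃ₗ[R] LinearMap.range τ) := by
  let β : T →ₗ[R] LinearMap.ker S.g.hom := α.codRestrict _ hα
  have hβ : Function.Surjective ((LinearMap.range S.moduleCatToCycles).mkQ ∘ₗ β) := by
    rintro ⟨⟨z, hz⟩⟩
    obtain ⟨t, rfl⟩ := hsurj z hz
    exact ⟨t, rfl⟩
  have hk : LinearMap.ker ((LinearMap.range S.moduleCatToCycles).mkQ ∘ₗ β) = LinearMap.ker τ := by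
    ext t
    rw [LinearMap.mem_ker, LinearMap.mem_ker, ← hker, LinearMap.comp_apply, Submodule.mkQ_apply,
      Submodule.Quotient.mk_eq_zero]
    constructor
    · rintro ⟨w, hw⟩
      exact ⟨w, congrArg Subtype.val hw⟩
    · rintro ⟨w, hw⟩
      exact ⟨w, Subtype.ext hw⟩
  exact ⟨S.moduleCatHomologyIso.toLinearEquiv ≪≫ₗ
    (LinearMap.quotKerEquivOfSurjective _ hβ).symm ≪≫ₗ
    Submodule.quotEquivOfEq _ _ hk ≪≫ₗ τ.quotKerEquivRange⟩

section Resolution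

variable {R : Type u} [CommRing R] {P₂ P₁ P₀ k : Type*} [AddCommGroup P₂] [Module R P₂]
  [AddCommGroup P₁] [Module R P₁] [AddCommGroup P₀] [Module R P₀] [AddCommGroup k] [Module R k]
  {d₂ : P₂ →ₗ[R] P₁} {d₁ : P₁ →ₗ[R] P₀} {π : P₀ →ₗ[R] k}

theorem Function.Exact.exists_linearMap_comp_eq {M : Type*} [AddCommGroup M] [Module R M]
    (hex : Function.Exact d₁ π) (hπ : Function.Surjective π) {ψ : P₀ →ₗ[R] M}
    (hψ : ∀ p, ψ (d₁ p) = 0) : ∃ g : k →ₗ[R] M, g ∘ₗ π = ψ := by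
  have hk : LinearMap.ker π ≤ LinearMap.ker ψ := fun z hz => by
    obtain ⟨p, rfl⟩ := (hex z).1 hz
    exact hψ p
  refine ⟨(LinearMap.ker π).liftQ ψ hk ∘ₗ (π.quotKerEquivOfSurjective hπ).symm, ?_⟩
  ext p
  have : (π.quotKerEquivOfSurjective hπ).symm (π p) = (LinearMap.ker π).mkQ p := by
    rw [LinearEquiv.symm_apply_eq]
    rfl
  simp [this]

theorem Function.Exact.exists_linearMap_apply_eq {J : Ideal R} (hex : Function.Exact d₁ π)
    (hex₂ : Function.Exact d₂ d₁) {m : Ideal R} (hm : ∀ a ∈ m, ∀ z : k, a • z = 0)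
    {x : R} (hxm : x ∈ m) (hx : x ∈ nonZeroDivisors R)
    (hJ : ∀ z, (∀ a ∈ m, a * z ∈ Ideal.span {x} * J) → x ∣ z)
    {ψ : P₁ →ₗ[R] R} (hψJ : ∀ q, ψ q ∈ J) (hψ : ∀ q, ψ (d₂ q) = 0) :
    ∃ φ : P₀ →ₗ[R] R, ∀ q, φ (d₁ q) = ψ q := by
  have hwell : ∀ q q', d₁ q = d₁ q' → ψ q = ψ q' := fun q q' h => by
    obtain ⟨p, hp⟩ := (hex₂ (q - q')).1 (by rw [map_sub, h, sub_self])
    rw [← sub_eq_zero, ← map_sub, ← hp, hψ]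
  have hlift : ∀ a ∈ m, ∀ p, ∃ q, d₁ q = a • p := fun a ha p =>
    (hex (a • p)).1 (by rw [map_smul, hm a ha])
  choose q hq using fun p => hlift x hxm p
  have hdvd : ∀ p, ∃ c, ψ (q p) = x * c := fun p => by
    refine hJ _ fun a ha => ?_
    obtain ⟨q', hq'⟩ := hlift a ha p
    have : a * ψ (q p) = x * ψ q' := by
      rw [← smul_eq_mul, ← smul_eq_mul, ← map_smul, ← map_smul]
      exact hwell _ _ (by rw [map_smul, map_smul, hq, hq', smul_comm])
    rw [this]
    exact Ideal.mul_mem_mul (Ideal.mem_span_singleton_self x) (hψJ _)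
  choose c hc using hdvd
  have hcancel : ∀ {b b' : R}, x * b = x * b' → b = b' := fun h =>
    (mul_cancel_left_mem_nonZeroDivisors hx).1 h
  refine ⟨{ toFun := c, map_add' := fun p p' => hcancel ?_, map_smul' := fun r p => hcancel ?_ },
    fun p => hcancel ?_⟩
  · rw [mul_add, ← hc, ← hc, ← hc, ← map_add]
    exact hwell _ _ (by rw [map_add, hq, hq, hq, smul_add])
  · rw [RingHom.id_apply, smul_eq_mul, mul_left_comm, ← hc, ← hc, ← smul_eq_mul, ← map_smul]
    exact hwell _ _ (by rw [map_smul, hq, hq, smul_comm])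
  · change x * c (d₁ p) = _
    rw [← hc, ← smul_eq_mul, ← map_smul]
    exact hwell _ _ (by rw [map_smul, hq])

theorem Function.Exact.exists_comp_eq_iff_forall_mem {J : Ideal R} (hex : Function.Exact d₁ π)
    {x : R} (hxk : ∀ z : k, x • z = 0) (hx : x ∈ nonZeroDivisors R) (φ : P₀ →ₗ[R] R) :
    (∃ w : P₀ →ₗ[R] J, ∀ q, (w (d₁ q) : R) = φ (d₁ q)) ↔ ∀ p, φ p ∈ J := by
  refine ⟨fun ⟨w, hw⟩ p => ?_, fun h => ⟨φ.codRestrict J h, fun q => rfl⟩⟩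
  obtain ⟨q, hq⟩ := (hex (x • p)).1 (by rw [map_smul, hxk])
  have := hw q
  rw [hq, map_smul, map_smul, Submodule.coe_smul, smul_eq_mul, smul_eq_mul,
    mul_cancel_left_mem_nonZeroDivisors hx] at this
  exact this ▸ (w p).2

end Resolution

theorem nonempty_ext_one_linearEquiv {R : Type u} [CommRing R] [IsLocalRing R]
    {x : R} (hxm : x ∈ maximalIdeal R) (hx : x ∈ nonZeroDivisors R) {J : Ideal R}
    (hJ : ∀ z, (∀ a ∈ maximalIdeal R, a * z ∈ Ideal.span {x} * J) → x ∣ z) :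
    Nonempty ((((_root_.Ext R (ModuleCat.{u} R) 1).obj
      (Opposite.op (ModuleCat.of R (ResidueField R)))).obj (ModuleCat.of R J)) ≃ₗ[R]
        (ResidueField R →ₗ[R] R ⧸ J)) := by
  let P := projectiveResolution (ModuleCat.of R (ResidueField R))
  let K := P.complex.linearYonedaObj R (ModuleCat.of R J)
  let d₁ : P.complex.X 1 →ₗ[R] P.complex.X 0 := (P.complex.d 1 0).hom
  let d₂ : P.complex.X 2 →ₗ[R] P.complex.X 1 := (P.complex.d 2 1).hom
  let π : P.complex.X 0 →ₗ[R] ResidueField R := (P.π.f 0).hom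
  have hπ : Function.Surjective π := (ModuleCat.epi_iff_surjective (P.π.f 0)).1 inferInstance
  have hex : Function.Exact d₁ π :=
    (ShortComplex.ShortExact.moduleCat_exact_iff_function_exact
      (ShortComplex.mk _ _ P.complex_d_comp_π_f_zero)).1
      (ShortComplex.exact_of_g_is_cokernel _ P.isColimitCokernelCofork)
  have hex₂ : Function.Exact d₂ d₁ :=
    (ShortComplex.ShortExact.moduleCat_exact_iff_function_exact _).1 (P.exact_succ 0)
  have : Module.Projective R (P.complex.X 0) :=
    (IsProjective.iff_projective (P.complex.X 0)).2 (P.projective 0)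
  have hm : ∀ a ∈ maximalIdeal R, ∀ z : ResidueField R, a • z = 0 := fun a ha z => by
    rw [Algebra.smul_def, ResidueField.algebraMap_eq, (residue_eq_zero_iff a).2 ha, zero_mul]
  let T : Submodule R (P.complex.X 0 →ₗ[R] R) :=
    { carrier := {φ | ∀ p, φ (d₁ p) ∈ J}
      add_mem' := fun h₁ h₂ p => J.add_mem (h₁ p) (h₂ p)
      zero_mem' := fun p => J.zero_mem
      smul_mem' := fun r φ h p => J.mul_mem_left r (h p) }
  let τ : T →ₗ[R] (P.complex.X 0 →ₗ[R] R ⧸ J) := (LinearMap.compRight R J.mkQ) ∘ₗ T.subtype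
  let α : T →ₗ[R] (K.sc' 0 1 2).X₂ :=
    { toFun := fun φ => ModuleCat.ofHom ((φ.1 ∘ₗ d₁).codRestrict J φ.2)
      map_add' := fun _ _ => rfl
      map_smul' := fun _ _ => rfl }
  let hom (n : ℕ) (w : P.complex.X n ⟶ ModuleCat.of R J) : P.complex.X n →ₗ[R] J := w.hom
  have hrange : LinearMap.range τ = LinearMap.range (LinearMap.lcomp R (R ⧸ J) π) := by
    apply le_antisymm
    · rintro _ ⟨φ, rfl⟩
      exact hex.exists_linearMap_comp_eq hπ fun p => Ideal.Quotient.eq_zero_iff_mem.2 (φ.2 p)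
    · rintro _ ⟨g, rfl⟩
      obtain ⟨φ, hφ⟩ := Module.projective_lifting_property J.mkQ (g ∘ₗ π) J.mkQ_surjective
      refine ⟨⟨φ, fun p => Ideal.Quotient.eq_zero_iff_mem.1 ?_⟩, hφ⟩
      have := LinearMap.congr_fun hφ (d₁ p)
      rw [LinearMap.comp_apply, LinearMap.comp_apply, hex.apply_apply_eq_zero, map_zero] at this
      exact this
  have hinj : Function.Injective (LinearMap.lcomp R (R ⧸ J) π) :=
    fun a b hab => LinearMap.ext <| hπ.forall.2 (LinearMap.congr_fun hab)
  have hα : ∀ t, (K.sc' 0 1 2).g (α t) = 0 := fun t => by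
    refine ModuleCat.hom_ext (LinearMap.ext fun q => Subtype.ext ?_)
    change t.1 (d₁ (d₂ q)) = 0
    rw [hex₂.apply_apply_eq_zero, map_zero]
  have hsurj : ∀ z, (K.sc' 0 1 2).g z = 0 → ∃ t, α t = z := fun z hz => by
    obtain ⟨φ, hφ⟩ := hex.exists_linearMap_apply_eq hex₂ hm hxm hx hJ
      (ψ := J.subtype ∘ₗ hom 1 z)
      (fun q => Subtype.prop _)
      (fun q => congrArg Subtype.val (LinearMap.congr_fun
        (congrArg (hom 2) hz) q))
    refine ⟨⟨φ, fun p => ?_⟩, ModuleCat.hom_ext (LinearMap.ext fun q => Subtype.ext (hφ q))⟩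
    rw [hφ]
    exact Subtype.prop _
  have hker : ∀ t, (∃ w, (K.sc' 0 1 2).f w = α t) ↔ τ t = 0 := fun t => by
    have h₁ := hex.exists_comp_eq_iff_forall_mem (J := J) (hm x hxm) hx t.1
    have h₂ : τ t = 0 ↔ ∀ p, t.1 p ∈ J := by
      rw [LinearMap.ext_iff]
      exact forall_congr' fun p => Ideal.Quotient.eq_zero_iff_mem
    rw [h₂, ← h₁]
    constructor
    · rintro ⟨w, hw⟩
      exact ⟨hom 0 w, fun q =>
        congrArg Subtype.val (LinearMap.congr_fun
          (congrArg (hom 1) hw) q)⟩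
    · rintro ⟨w, hw⟩
      exact ⟨ModuleCat.ofHom w, ModuleCat.hom_ext (LinearMap.ext fun q => Subtype.ext (hw q))⟩
  obtain ⟨E⟩ := (K.sc' 0 1 2).nonempty_homology_linearEquiv_range
    (T := T) (V := P.complex.X 0 →ₗ[R] R ⧸ J) α τ hα hsurj hker
  exact ⟨((P.isoExt 1 (ModuleCat.of R J)) ≪≫ ShortComplex.homologyMapIso
    (K.isoSc' 0 1 2 (by simp) (by simp))).toLinearEquiv ≪≫ₗ E ≪≫ₗ
    LinearEquiv.ofEq _ _ hrange ≪≫ₗ (LinearEquiv.ofInjective _ hinj).symm⟩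

theorem mI_elias_of_mu (R : Type u) [CommRing R] [IsLocalRing R] [IsNoetherianRing R]
    (hdim : ringKrullDim R = 1)
    (hCM : ∃ x ∈ maximalIdeal R, x ∈ nonZeroDivisors R)
    (e : ℕ) (he : HasMultiplicity R e)
    (I : Ideal R) (hI : IsMPrimary R I)
    (hmu1 : mu R (maximalIdeal R * I) ≤ mu R I)
    (hmu2 : mu R I = ((e - 1 : ℕ) : WithBot ℕ∞)) :
    EliasIdeal R (maximalIdeal R * I) ∧
      (maximalIdeal R * I).colon (maximalIdeal R) = I := by
  have hlen : ∀ (M : Type u) [AddCommGroup M] [Module R M],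
      rlength R M = (Module.length R M : WithBot ℕ∞) := fun M _ _ => (Module.coe_length R M).symm
  obtain ⟨x, hxm, hx⟩ := hCM
  obtain ⟨N, hN⟩ := he
  have : Ring.KrullDimLE 1 R := (Order.krullDimLE_iff 1 _).2 hdim.le
  have key : ∀ z, (∀ a ∈ maximalIdeal R, a * z ∈ Ideal.span {x} * (maximalIdeal R * I)) →
      z ∈ Ideal.span {x} * I := fun z hz => by
    rw [hmu2] at hmu1
    unfold mu at hmu1 hmu2
    rw [hlen] at hmu1 hmu2
    simp only [hlen] at hN
    exact mem_span_singleton_mul_of_forall_mul_mem hxm hx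
      (fun n hn => WithBot.coe_injective (hN n hn)) hI.ge (WithBot.coe_injective hmu2)
      (WithBot.coe_le_coe.1 hmu1) hz
  constructor
  · obtain ⟨E⟩ := nonempty_ext_one_linearEquiv hxm hx (J := maximalIdeal R * I) fun z hz => by
      obtain ⟨y, -, rfl⟩ := Ideal.mem_span_singleton_mul.1 (key z hz)
      exact dvd_mul_right x y
    unfold EliasIdeal idealType modType quotType
    rw [hlen, hlen, E.length_eq]
  · ext y
    rw [Submodule.mem_colon]
    refine ⟨fun hy => ?_, fun hy a ha => ?_⟩
    · obtain ⟨y', hy', h⟩ := Ideal.mem_span_singleton_mul.1 <| key (x * y) fun a ha => by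
        rw [mul_left_comm a, mul_comm a]
        exact Ideal.mul_mem_mul (Ideal.mem_span_singleton_self x) (hy a ha)
      exact (mul_cancel_left_mem_nonZeroDivisors hx).1 h ▸ hy'
    · rw [smul_eq_mul, mul_comm y]
      exact Ideal.mul_mem_mul ha hy
end

section
/- Let (R, m) be a one-dimensional Cohen-Macaulay local ring whose integral closure R̄ in Q(R) is finite over R. Then the conductor c_R(R̄) is not an Elias ideal. -/
open CategoryTheory IsLocalRing

set_option synthInstance.maxHeartbeats 1000000
set_option maxHeartbeats 1000000

universe u

/-- The conductor `c_R(S) = R :_Q S` of a subalgebra `R ⊆ S ⊆ Q(R)`, as an ideal of `R`. -/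
noncomputable def conductorIdeal (R : Type u) [CommRing R]
    (S : Subalgebra R (FractionRing R)) : Ideal R :=
  Submodule.colon (Subalgebra.toSubmodule (⊥ : Subalgebra R (FractionRing R)))
    (Subalgebra.toSubmodule S)

theorem HomologicalComplex.exists_linearMap_homology {R : Type u} [CommRing R]
    (K : CochainComplex (ModuleCat.{u} R) ℕ) {A : Type u} [AddCommGroup A] [Module R A]
    (f : A →ₗ[R] K.X 1) (hf : ∀ a, (K.d 1 2).hom (f a) = 0) :
    ∃ T : A →ₗ[R] K.homology 1, ∀ a, T a = 0 → ∃ y, (K.d 0 1).hom y = f a := by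
  have hz : ModuleCat.ofHom f ≫ K.d 1 2 = 0 := by
    ext a
    exact hf a
  let l := K.liftCycles (ModuleCat.ofHom f) 2 (by simp) hz
  refine ⟨(l ≫ K.homologyπ 1).hom, fun a ha ↦ ?_⟩
  have hex : (ShortComplex.mk _ _ (K.toCycles_comp_homologyπ 0 1)).Exact :=
    ShortComplex.exact_of_g_is_cokernel _ (K.homologyIsCokernel 0 1 (by simp))
  rw [ShortComplex.moduleCat_exact_iff] at hex
  obtain ⟨y, hy⟩ := hex (l.hom a) ha
  refine ⟨y, ?_⟩
  have h1 : (K.toCycles 0 1 ≫ K.iCycles 1) y = K.d 0 1 y := by rw [K.toCycles_i]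
  have h2 : (l ≫ K.iCycles 1) a = f a := by
    rw [K.liftCycles_i]
    rfl
  rw [← h2]
  refine h1.symm.trans ?_
  exact congrArg (K.iCycles 1) hy

theorem CategoryTheory.ProjectiveResolution.exists_linearMap_ext {R : Type u} [CommRing R]
    {X : ModuleCat.{u} R} (P : ProjectiveResolution X) (Y : ModuleCat.{u} R)
    {A : Type u} [AddCommGroup A] [Module R A]
    (f : A →ₗ[R] P.complex.X 1 →ₗ[R] Y) (hf : ∀ a, f a ∘ₗ (P.complex.d 2 1).hom = 0) :
    ∃ T : A →ₗ[R] ((_root_.Ext R (ModuleCat.{u} R) 1).obj (Opposite.op X)).obj Y,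
      ∀ a, T a = 0 → ∃ y : P.complex.X 0 →ₗ[R] Y, y ∘ₗ (P.complex.d 1 0).hom = f a := by
  let e : (P.complex.X 1 →ₗ[R] Y) →ₗ[R] (P.complex.linearYonedaObj R Y).X 1 :=
    (ModuleCat.homLinearEquiv (S := R)).symm.toLinearMap
  obtain ⟨T, hT⟩ := HomologicalComplex.exists_linearMap_homology
    (P.complex.linearYonedaObj R Y) (e ∘ₗ f) (fun a ↦ by
      rw [ChainComplex.linearYonedaObj_d]
      exact ModuleCat.hom_ext (hf a))
  refine ⟨(P.isoExt (R := R) 1 Y).inv.hom ∘ₗ T, fun a ha ↦ ?_⟩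
  have : T a = 0 := by
    have := congrArg (P.isoExt (R := R) 1 Y).hom.hom ha
    simpa using this
  obtain ⟨y, hy⟩ := hT a this
  rw [ChainComplex.linearYonedaObj_d] at hy
  exact ⟨ModuleCat.Hom.hom y, congrArg ModuleCat.Hom.hom hy⟩

theorem CategoryTheory.ProjectiveResolution.hom_zero_surjective {R : Type u} [CommRing R]
    {X : ModuleCat.{u} R} (P : ProjectiveResolution X) :
    ∃ π : P.complex.X 0 →ₗ[R] X, Function.Surjective π ∧
      Function.Exact (P.complex.d 1 0).hom π := by
  refine ⟨(P.π.f 0).hom, (ModuleCat.epi_iff_surjective (P.π.f 0)).mp inferInstance, ?_⟩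
  exact (ShortComplex.ShortExact.moduleCat_exact_iff_function_exact _).mp P.exact₀

/-- The submodule `N :_M I` of elements of `M` multiplied into `N` by the ideal `I`. -/
def Submodule.idealColon {R M : Type*} [CommRing R] [AddCommGroup M] [Module R M]
    (N : Submodule R M) (I : Ideal R) : Submodule R M where
  carrier := {q | ∀ r ∈ I, r • q ∈ N}
  add_mem' ha hb r hr := by
    rw [smul_add]
    exact N.add_mem (ha r hr) (hb r hr)
  zero_mem' r _ := by simp
  smul_mem' s q hq r hr := by
    rw [smul_comm]
    exact N.smul_mem s (hq r hr)

/-- Multiplication of elements of `range ι :_Q I` by elements of `I`, as a map into `M`. -/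
noncomputable def LinearMap.idealColonMul {R M Q : Type*} [CommRing R] [AddCommGroup M]
    [Module R M] [AddCommGroup Q] [Module R Q] (ι : M →ₗ[R] Q) (hι : Function.Injective ι)
    (I : Ideal R) : ι.range.idealColon I →ₗ[R] I →ₗ[R] M :=
  LinearMap.mk₂ R (fun q r ↦ (LinearEquiv.ofInjective ι hι).symm ⟨r.1 • q.1, q.2 r.1 r.2⟩)
    (fun q q' r ↦ by rw [← map_add]; congr 1; ext; simp)
    (fun c q r ↦ by rw [← map_smul]; congr 1; ext; exact smul_comm _ _ _)
    (fun q r r' ↦ by rw [← map_add]; congr 1; ext; simp [add_smul])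
    (fun c q r ↦ by rw [← map_smul]; congr 1; ext; simp [mul_smul])

theorem LinearMap.apply_idealColonMul {R M Q : Type*} [CommRing R] [AddCommGroup M]
    [Module R M] [AddCommGroup Q] [Module R Q] (ι : M →ₗ[R] Q) (hι : Function.Injective ι)
    (I : Ideal R) (q : ι.range.idealColon I) (r : I) :
    ι (ι.idealColonMul hι I q r) = r.1 • q.1 :=
  congrArg Subtype.val
    ((LinearEquiv.ofInjective ι hι).apply_symm_apply ⟨r.1 • q.1, q.2 r.1 r.2⟩)

theorem exists_linearMap_ext_residueField {R : Type u} [CommRing R] [IsLocalRing R]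
    {M Q : Type u} [AddCommGroup M] [Module R M] [AddCommGroup Q] [Module R Q]
    (ι : M →ₗ[R] Q) (hι : Function.Injective ι) {x : R} (hx : x ∈ maximalIdeal R)
    (hxQ : ∀ q : Q, x • q = 0 → q = 0) :
    ∃ T : ι.range.idealColon (maximalIdeal R) →ₗ[R]
        ((_root_.Ext R (ModuleCat.{u} R) 1).obj
          (Opposite.op (ModuleCat.of R (ResidueField R)))).obj (ModuleCat.of R M),
      ∀ a, T a = 0 → a.1 ∈ ι.range := by
  let P : ProjectiveResolution (ModuleCat.of R (ResidueField R)) :=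
    (HasProjectiveResolution.out).some
  obtain ⟨π, hπ, hex⟩ := P.hom_zero_surjective
  have hproj : Module.Projective R (P.complex.X 0) := by
    have := P.projective 0
    exact (IsProjective.iff_projective _).mpr this
  let res : R →ₗ[R] ResidueField R := Algebra.linearMap R (ResidueField R)
  obtain ⟨φ, hφ⟩ := Module.projective_lifting_property res
    (show P.complex.X 0 →ₗ[R] ResidueField R from π) residue_surjective
  have hφ' (p) : residue R (φ p) = π p := LinearMap.congr_fun hφ p
  let d : P.complex.X 1 →ₗ[R] P.complex.X 0 := (P.complex.d 1 0).hom
  have hmem (p) : φ p ∈ maximalIdeal R ↔ π p = 0 := by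
    rw [← hφ', residue_eq_zero_iff]
  let ψ : P.complex.X 1 →ₗ[R] maximalIdeal R :=
    (φ ∘ₗ d).codRestrict (maximalIdeal R)
      (fun p ↦ (hmem _).mpr (hex.apply_apply_eq_zero p))
  have hdd (p) : d ((P.complex.d 2 1).hom p) = 0 :=
    LinearMap.congr_fun (congrArg ModuleCat.Hom.hom (P.complex.d_comp_d 2 1 0)) p
  have hψ (p) : ψ ((P.complex.d 2 1).hom p) = 0 := by
    ext
    change φ (d _) = 0
    rw [hdd, map_zero]
  obtain ⟨T, hT⟩ := P.exists_linearMap_ext (ModuleCat.of R M)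
    (LinearMap.lcomp R M ψ ∘ₗ ι.idealColonMul hι (maximalIdeal R)) (fun a ↦ by
      ext p
      change ι.idealColonMul hι _ a (ψ _) = 0
      rw [hψ, map_zero])
  refine ⟨T, fun a ha ↦ ?_⟩
  obtain ⟨y, hy⟩ := hT a ha
  let y' : P.complex.X 0 →ₗ[R] M := y
  have hker (p) (hp : π p = 0) : φ p • a.1 = ι (y' p) := by
    obtain ⟨p, rfl⟩ := (hex p).mp hp
    have h1 : y' (d p) = ι.idealColonMul hι _ a (ψ p) := LinearMap.congr_fun hy p
    change _ = ι (y' (d p))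
    rw [h1, ι.apply_idealColonMul]
    rfl
  have hall (p) : φ p • a.1 = ι (y' p) := by
    rw [← sub_eq_zero]
    apply hxQ
    have h0 : π (x • p) = 0 := by
      rw [← hmem, map_smul, smul_eq_mul]
      exact Ideal.mul_mem_right _ _ hx
    have := hker (x • p) h0
    rw [smul_sub, sub_eq_zero, ← map_smul, ← map_smul, ← this, map_smul, smul_assoc]
  obtain ⟨p, hp⟩ := hπ (1 : ResidueField R)
  have hu : IsUnit (φ p) := by
    by_contra h
    have h0 := (hmem p).mp ((mem_maximalIdeal _).mpr h)
    exact one_ne_zero (hp.symm.trans h0)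
  obtain ⟨v, hv⟩ := hu.exists_left_inv
  refine ⟨v • y' p, ?_⟩
  rw [map_smul, ← hall, smul_smul, hv, one_smul]

theorem Module.length_ne_top_of_isTorsionBySet_maximalIdeal {R M : Type*} [CommRing R]
    [IsLocalRing R] [AddCommGroup M] [Module R M] [IsNoetherian R M]
    (h : Module.IsTorsionBySet R M (maximalIdeal R)) : Module.length R M ≠ ⊤ := by
  let _ := h.module
  let _ : Field (R ⧸ maximalIdeal R) := Ideal.Quotient.field _
  have : IsSemisimpleModule R M := h.isSemisimpleModule_iff.mp inferInstance
  exact Module.length_ne_top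

theorem EliasIdeal.exists_algebraMap_eq {R : Type u} [CommRing R] [IsLocalRing R]
    [IsNoetherianRing R] {I : Ideal R} (hI : EliasIdeal R I) {x : R} (hx : x ∈ maximalIdeal R)
    (hx0 : x ∈ nonZeroDivisors R) {q : FractionRing R}
    (hq : ∀ r ∈ maximalIdeal R, ∃ i ∈ I, algebraMap R (FractionRing R) i = r • q) :
    ∃ s, algebraMap R (FractionRing R) s = q := by
  have hinj : Function.Injective (algebraMap R (FractionRing R)) :=
    IsFractionRing.injective R (FractionRing R)
  let j : R →ₗ[R] FractionRing R := Algebra.linearMap R (FractionRing R)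
  let ι : I →ₗ[R] FractionRing R := j ∘ₗ I.subtype
  have hι : Function.Injective ι := hinj.comp Subtype.val_injective
  have hN (s : R) : j s ∈ ι.range ↔ s ∈ I :=
    ⟨fun ⟨i, hi⟩ ↦ hinj hi ▸ i.2, fun hs ↦ ⟨⟨s, hs⟩, rfl⟩⟩
  obtain ⟨T, hT⟩ := exists_linearMap_ext_residueField ι hι hx (fun q hq ↦ by
    have hu : IsUnit (algebraMap R (FractionRing R) x) :=
      IsLocalization.map_units (FractionRing R) ⟨x, hx0⟩
    rwa [Algebra.smul_def, hu.mul_right_eq_zero] at hq)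
  let p : ι.range.idealColon (maximalIdeal R) →ₗ[R] FractionRing R ⧸ ι.range :=
    ι.range.mkQ ∘ₗ Submodule.subtype _
  have hTp : LinearMap.ker T ≤ LinearMap.ker p := fun a ha ↦
    (Submodule.Quotient.mk_eq_zero _).mpr (hT a ha)
  let f : R ⧸ I →ₗ[R] FractionRing R ⧸ ι.range :=
    I.mapQ ι.range j fun s hs ↦ (hN s).mpr hs
  let g : (ResidueField R →ₗ[R] R ⧸ I) →ₗ[R] FractionRing R ⧸ ι.range :=
    f ∘ₗ LinearMap.applyₗ (1 : ResidueField R)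
  have hg1 (h : ResidueField R →ₗ[R] R ⧸ I) : ∃ s : R, g h = ι.range.mkQ (j s) ∧
      h 1 = I.mkQ s := by
    obtain ⟨s, hs⟩ := I.mkQ_surjective (h 1)
    refine ⟨s, ?_, hs.symm⟩
    change f (h 1) = _
    rw [← hs]
    rfl
  have hkill (h : ResidueField R →ₗ[R] R ⧸ I) (r : R) (hr : r ∈ maximalIdeal R) : r • h = 0 := by
    ext k
    obtain ⟨s, rfl⟩ := residue_surjective k
    rw [LinearMap.smul_apply, ← map_smul, ← residue_eq_zero_iff] at *
    rw [Algebra.smul_def]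
    change h (residue R r * _) = 0
    rw [hr, zero_mul, map_zero]
  have hg : Function.Injective g := by
    refine (injective_iff_map_eq_zero g).mpr fun h hh ↦ ?_
    obtain ⟨s, hs, hs'⟩ := hg1 h
    have h1 : h 1 = 0 := by
      rw [hs', Submodule.mkQ_apply, Submodule.Quotient.mk_eq_zero, ← hN,
        ← Submodule.Quotient.mk_eq_zero]
      exact hs.symm.trans hh
    ext k
    obtain ⟨r, rfl⟩ := residue_surjective k
    have : residue R r = r • (1 : ResidueField R) := by
      rw [Algebra.smul_def, mul_one]
      rfl
    rw [this, map_smul, h1, smul_zero, LinearMap.zero_apply]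
  have hle : LinearMap.range g ≤ LinearMap.range p := by
    rintro _ ⟨h, rfl⟩
    obtain ⟨s, hs, hs'⟩ := hg1 h
    refine ⟨⟨j s, fun r hr ↦ ?_⟩, hs.symm⟩
    rw [← map_smul, hN, ← Submodule.Quotient.mk_eq_zero, Submodule.Quotient.mk_smul,
      ← Submodule.mkQ_apply, ← hs', ← LinearMap.smul_apply, hkill h r hr, LinearMap.zero_apply]
  have hnoeth : IsNoetherian R (ResidueField R →ₗ[R] R ⧸ I) :=
    isNoetherian_of_injective (LinearMap.applyₗ (1 : ResidueField R)) fun h h' hh ↦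
      hg (congrArg f hh)
  have hfin : Module.length R (ResidueField R →ₗ[R] R ⧸ I) ≠ ⊤ :=
    Module.length_ne_top_of_isTorsionBySet_maximalIdeal fun h r ↦ hkill h r r.2
  have hext : Module.length R (((_root_.Ext R (ModuleCat.{u} R) 1).obj
      (Opposite.op (ModuleCat.of R (ResidueField R)))).obj (ModuleCat.of R I)) =
      Module.length R (ResidueField R →ₗ[R] R ⧸ I) := by
    apply WithBot.coe_injective
    rw [Module.coe_length, Module.coe_length]
    exact hI
  have hlen : Module.length R (LinearMap.range p) ≤ Module.length R (LinearMap.range g) :=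
    calc Module.length R (LinearMap.range p)
      _ = Module.length R (_ ⧸ LinearMap.ker p) := p.quotKerEquivRange.length_eq.symm
      _ ≤ Module.length R (_ ⧸ LinearMap.ker T) :=
        Module.length_le_of_surjective (Submodule.factor hTp) (Submodule.factor_surjective hTp)
      _ = Module.length R (LinearMap.range T) := T.quotKerEquivRange.length_eq
      _ ≤ Module.length R (ResidueField R →ₗ[R] R ⧸ I) :=
        (Module.length_le_of_injective _ (Submodule.subtype_injective _)).trans_eq hext
      _ = Module.length R (LinearMap.range g) := (LinearEquiv.ofInjective g hg).length_eq
  have heq : LinearMap.range g = LinearMap.range p := by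
    by_contra hne
    rw [(LinearEquiv.ofInjective g hg).length_eq, Module.length_submodule] at hfin
    rw [Module.length_submodule, Module.length_submodule] at hlen
    exact hlen.not_gt (Order.height_strictMono (hle.lt_of_ne hne) hfin.lt_top)
  let a : ι.range.idealColon (maximalIdeal R) :=
    ⟨q, fun r hr ↦ let ⟨i, hi, h⟩ := hq r hr; ⟨⟨i, hi⟩, h⟩⟩
  obtain ⟨h, hh⟩ : p a ∈ LinearMap.range g := heq ▸ ⟨a, rfl⟩
  obtain ⟨s, hs, -⟩ := hg1 h
  obtain ⟨i, hi⟩ : j s - q ∈ ι.range := (Submodule.Quotient.eq _).mp (hs.symm.trans hh)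
  refine ⟨s - i, ?_⟩
  rw [map_sub, sub_eq_iff_eq_add, ← sub_eq_iff_eq_add']
  exact hi.symm

theorem Ideal.exists_mem_notMem_smul {R : Type*} [CommRing R] [IsLocalRing R]
    [IsNoetherianRing R] [Ring.KrullDimLE 1 R] {x : R} (hx : x ∈ maximalIdeal R)
    (hx0 : x ∈ nonZeroDivisors R) {I : Ideal R} (hI : I ≠ ⊥) :
    ∃ y ∈ I, (∀ i ∈ I, y ≠ x * i) ∧ ∀ r ∈ maximalIdeal R, ∃ i ∈ I, r * y = x * i := by
  let N : Submodule R I := LinearMap.range (LinearMap.lsmul R I x)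
  have hN (y : I) : y ∈ N ↔ ∃ i ∈ I, y.1 = x * i :=
    ⟨fun ⟨i, hi⟩ ↦ ⟨i, i.2, congrArg Subtype.val hi.symm⟩,
      fun ⟨i, hi, h⟩ ↦ ⟨⟨i, hi⟩, Subtype.ext h.symm⟩⟩
  have hnt : Nontrivial (I ⧸ N) := by
    rw [Submodule.Quotient.nontrivial_iff]
    intro htop
    refine hI (Submodule.eq_bot_of_le_smul_of_le_jacobson_bot (maximalIdeal R) I
      (IsNoetherian.noetherian I) (fun y hy ↦ ?_) (maximalIdeal_le_jacobson _))
    obtain ⟨i, hi, h⟩ := (hN ⟨y, hy⟩).mp (htop ▸ Submodule.mem_top)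
    rw [show y = x • i from h]
    exact Submodule.smul_mem_smul hx hi
  obtain ⟨P, hP⟩ := associatedPrimes.nonempty R (I ⧸ N)
  obtain ⟨hPp, z, hz⟩ := isAssociatedPrime_iff.mp hP
  obtain ⟨y, rfl⟩ := N.mkQ_surjective z
  have hmem (r : R) : r ∈ P ↔ ∃ i ∈ I, r * y = x * i := by
    rw [hz, Submodule.mem_colon_singleton, ← map_smul, Submodule.mem_bot, Submodule.mkQ_apply,
      Submodule.Quotient.mk_eq_zero, hN]
    rfl
  have hxP : x ∈ P := (hmem x).mpr ⟨y, y.2, rfl⟩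
  have hmax : P.IsMaximal := (Ring.krullDimLE_one_iff.mp inferInstance P hPp).resolve_left
    fun h ↦ Set.disjoint_left.mp (Ideal.disjoint_nonZeroDivisors_of_mem_minimalPrimes h) hxP hx0
  refine ⟨y, y.2, fun i hi h ↦ hPp.one_notMem ((hmem 1).mpr ⟨i, hi, by rwa [one_mul]⟩),
    fun r hr ↦ (hmem r).mp ?_⟩
  rwa [eq_maximalIdeal hmax]

theorem mem_conductorIdeal {R : Type u} [CommRing R] {S : Subalgebra R (FractionRing R)} {r : R} :
    r ∈ conductorIdeal R S ↔
      ∀ s ∈ S, ∃ t, algebraMap R (FractionRing R) t = algebraMap R (FractionRing R) r * s := by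
  simp only [conductorIdeal, Submodule.mem_colon, SetLike.mem_coe, Subalgebra.mem_toSubmodule,
    Algebra.mem_bot, Set.mem_range, Algebra.smul_def]

theorem conductorIdeal_ne_bot (R : Type u) [CommRing R] [Nontrivial R]
    (S : Subalgebra R (FractionRing R)) [Module.Finite R S] : conductorIdeal R S ≠ ⊥ := by
  obtain ⟨s, hs⟩ := (Module.Finite.iff_fg (N := Subalgebra.toSubmodule S)).mp ‹_›
  obtain ⟨b, hb⟩ := IsLocalization.exist_integer_multiples_of_finset (nonZeroDivisors R) s
  intro h
  refine nonZeroDivisors.coe_ne_zero b ?_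
  rw [← Submodule.mem_bot R, ← h, conductorIdeal, Submodule.mem_colon]
  intro q hq
  have hle : Subalgebra.toSubmodule S ≤ (Subalgebra.toSubmodule
      (⊥ : Subalgebra R (FractionRing R))).comap (LinearMap.lsmul R (FractionRing R) b.1) := by
    rw [← hs, Submodule.span_le]
    intro a ha
    exact Algebra.mem_bot.mpr (hb a ha)
  exact hle hq

theorem conductor_not_elias (R : Type u) [CommRing R] [IsLocalRing R] [IsNoetherianRing R]
    (hdim : ringKrullDim R = 1)
    (hCM : ∃ x ∈ maximalIdeal R, x ∈ nonZeroDivisors R)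
    [Module.Finite R (integralClosure R (FractionRing R))] :
    ¬ EliasIdeal R (conductorIdeal R (integralClosure R (FractionRing R))) := by
  intro hE
  obtain ⟨x, hx, hx0⟩ := hCM
  have : Ring.KrullDimLE 1 R := Ring.krullDimLE_iff.mpr hdim.le
  set S := integralClosure R (FractionRing R)
  obtain ⟨y, hy, hyx, hmy⟩ := Ideal.exists_mem_notMem_smul hx hx0 (conductorIdeal_ne_bot R S)
  let ρ := algebraMap R (FractionRing R)
  have hu : IsUnit (ρ x) := IsLocalization.map_units (FractionRing R) ⟨x, hx0⟩
  obtain ⟨q, hq⟩ : ∃ q, ρ x * q = ρ y := ⟨↑hu.unit⁻¹ * ρ y, hu.unit.mul_inv_cancel_left _⟩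
  have hqS (s) (hs : s ∈ S) : ∃ t, ρ t = q * s := by
    refine hE.exists_algebraMap_eq hx hx0 fun r hr ↦ ?_
    obtain ⟨i, hi, hri⟩ := hmy r hr
    obtain ⟨t, ht⟩ := mem_conductorIdeal.mp hi s hs
    refine ⟨t, mem_conductorIdeal.mpr fun s' hs' ↦ ?_, ?_⟩
    · obtain ⟨t', ht'⟩ := mem_conductorIdeal.mp hi (s * s') (S.mul_mem hs hs')
      exact ⟨t', by rw [ht', ht, mul_assoc]⟩
    · have hri' : ρ r * ρ y = ρ x * ρ i := by rw [← map_mul, hri, map_mul]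
      rw [ht, Algebra.smul_def]
      apply hu.mul_left_cancel
      linear_combination (-s) * hri' - ρ r * s * hq
  obtain ⟨a, ha⟩ := hqS 1 S.one_mem
  rw [mul_one] at ha
  refine hyx a (mem_conductorIdeal.mpr fun s hs ↦ ?_) ?_
  · obtain ⟨t, ht⟩ := hqS s hs
    exact ⟨t, ht.trans (by rw [← ha])⟩
  · apply IsFractionRing.injective R (FractionRing R)
    rw [map_mul]
    exact (hq.symm.trans (by rw [← ha]))
end
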